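/- Let p = 7 and let F₄₉ be the field with 49 elements. There exist NO elements A₁, B₁, A₂, B₂, λ, μ, ν of F₄₉ such that: (i) for i = 1, 2 one has 4A_i³ + 27B_i² ≠ 0 and the coefficient of x⁶ in (x³ + A_i x + B_i)³ ∈ F₄₉[x] is zero; (ii) μ ≠ 0, ν ≠ 0, and the polynomials f₁(x) = x³ + A₁μ²x + B₁μ³ and f₂(x) = (x−λ)³ + A₂ν²(x−λ) + B₂ν³ of F₄₉[x] are coprime; and (iii) the coefficients of x⁶, x¹³, x⁵ and x¹² in (f₁·f₂)³ are all zero. (Since every superspecial Howe curve is defined by such parameters over F_{p²}, this shows there is no superspecial Howe curve in characteristic 7.) -/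

import Mathlib

open Polynomial

instance : Fact (Nat.Prime 7) := ⟨by norm_num⟩

lemma howe_expand {R : Type*} [CommRing R] (b l : R) :
    (((X - C l) ^ 3 + C b * (X - C l) : R[X]) ^ 3) =
    C ((-1)*l^9 + (-3)*b^1*l^7 + (-3)*b^2*l^5 + (-1)*b^3*l^3 : R) * (X : R[X])^0 +
    C ((9)*l^8 + (21)*b^1*l^6 + (15)*b^2*l^4 + (3)*b^3*l^2 : R) * (X : R[X])^1 +
    C ((-36)*l^7 + (-63)*b^1*l^5 + (-30)*b^2*l^3 + (-3)*b^3*l^1 : R) * (X : R[X])^2 +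
    C ((84)*l^6 + (105)*b^1*l^4 + (30)*b^2*l^2 + (1)*b^3 : R) * (X : R[X])^3 +
    C ((-126)*l^5 + (-105)*b^1*l^3 + (-15)*b^2*l^1 : R) * (X : R[X])^4 +
    C ((126)*l^4 + (63)*b^1*l^2 + (3)*b^2 : R) * (X : R[X])^5 +
    C ((-84)*l^3 + (-21)*b^1*l^1 : R) * (X : R[X])^6 +
    C ((36)*l^2 + (3)*b^1 : R) * (X : R[X])^7 +
    C ((-9)*l^1 : R) * (X : R[X])^8 +
    C ((1) : R) * (X : R[X])^9 := by
  simp only [map_add, map_mul, map_pow, map_neg, map_ofNat, map_one]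
  ring

lemma g_coeff_1 {R : Type*} [CommRing R] (b l : R) :
    (((X - C l) ^ 3 + C b * (X - C l) : R[X]) ^ 3).coeff 1 =
    (9)*l^8 + (21)*b^1*l^6 + (15)*b^2*l^4 + (3)*b^3*l^2 := by
  rw [howe_expand]
  simp only [coeff_add, coeff_C_mul, coeff_X_pow]
  norm_num

lemma g_coeff_3 {R : Type*} [CommRing R] (b l : R) :
    (((X - C l) ^ 3 + C b * (X - C l) : R[X]) ^ 3).coeff 3 =
    (84)*l^6 + (105)*b^1*l^4 + (30)*b^2*l^2 + (1)*b^3 := by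
  rw [howe_expand]
  simp only [coeff_add, coeff_C_mul, coeff_X_pow]
  norm_num

lemma g_coeff_4 {R : Type*} [CommRing R] (b l : R) :
    (((X - C l) ^ 3 + C b * (X - C l) : R[X]) ^ 3).coeff 4 =
    (-126)*l^5 + (-105)*b^1*l^3 + (-15)*b^2*l^1 := by
  rw [howe_expand]
  simp only [coeff_add, coeff_C_mul, coeff_X_pow]
  norm_num

lemma g_coeff_5 {R : Type*} [CommRing R] (b l : R) :
    (((X - C l) ^ 3 + C b * (X - C l) : R[X]) ^ 3).coeff 5 =
    (126)*l^4 + (63)*b^1*l^2 + (3)*b^2 := by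
  rw [howe_expand]
  simp only [coeff_add, coeff_C_mul, coeff_X_pow]
  norm_num

lemma g_coeff_6 {R : Type*} [CommRing R] (b l : R) :
    (((X - C l) ^ 3 + C b * (X - C l) : R[X]) ^ 3).coeff 6 =
    (-84)*l^3 + (-21)*b^1*l^1 := by
  rw [howe_expand]
  simp only [coeff_add, coeff_C_mul, coeff_X_pow]
  norm_num

lemma g_coeff_7 {R : Type*} [CommRing R] (b l : R) :
    (((X - C l) ^ 3 + C b * (X - C l) : R[X]) ^ 3).coeff 7 =
    (36)*l^2 + (3)*b^1 := by
  rw [howe_expand]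
  simp only [coeff_add, coeff_C_mul, coeff_X_pow]
  norm_num

lemma g_coeff_8 {R : Type*} [CommRing R] (b l : R) :
    (((X - C l) ^ 3 + C b * (X - C l) : R[X]) ^ 3).coeff 8 =
    (-9)*l^1 := by
  rw [howe_expand]
  simp only [coeff_add, coeff_C_mul, coeff_X_pow]
  norm_num

lemma g_coeff_9 {R : Type*} [CommRing R] (b l : R) :
    (((X - C l) ^ 3 + C b * (X - C l) : R[X]) ^ 3).coeff 9 =
    (1) := by
  rw [howe_expand]
  simp only [coeff_add, coeff_C_mul, coeff_X_pow]
  norm_num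

lemma howe_split {R : Type*} [CommRing R] (a : R) (g : R[X]) :
    ((X ^ 3 + C a * X) * g) ^ 3 = g ^ 3 * X ^ 9 + C (3 * a) * (g ^ 3 * X ^ 7)
      + C (3 * a ^ 2) * (g ^ 3 * X ^ 5) + C (a ^ 3) * (g ^ 3 * X ^ 3) := by
  simp only [map_mul, map_pow, map_ofNat]
  ring

lemma howe_coeff_6 {R : Type*} [CommRing R] (a b l : R) :
    (((X ^ 3 + C a * X) * ((X - C l) ^ 3 + C b * (X - C l)) : R[X]) ^ 3).coeff 6 =
    (27)*a^2*l^8 + (63)*a^2*b^1*l^6 + (45)*a^2*b^2*l^4 + (9)*a^2*b^3*l^2 + (84)*a^3*l^6 + (105)*a^3*b^1*l^4 + (30)*a^3*b^2*l^2 + (1)*a^3*b^3 := by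
  have h10 : (((X - C l) ^ 3 + C b * (X - C l) : R[X]) ^ 3).coeff 10 = 0 := by
    rw [howe_expand]
    simp only [coeff_add, coeff_C_mul, coeff_X_pow]
    norm_num
  rw [howe_split]
  simp only [coeff_add, coeff_C_mul, coeff_mul_X_pow']
  norm_num [g_coeff_1, g_coeff_3, h10]
  ring

lemma howe_coeff_12 {R : Type*} [CommRing R] (a b l : R) :
    (((X ^ 3 + C a * X) * ((X - C l) ^ 3 + C b * (X - C l)) : R[X]) ^ 3).coeff 12 =
    (84)*l^6 + (105)*b^1*l^4 + (30)*b^2*l^2 + (1)*b^3 + (378)*a^1*l^4 + (189)*a^1*b^1*l^2 + (9)*a^1*b^2 + (108)*a^2*l^2 + (9)*a^2*b^1 + (1)*a^3 := by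
  have h10 : (((X - C l) ^ 3 + C b * (X - C l) : R[X]) ^ 3).coeff 10 = 0 := by
    rw [howe_expand]
    simp only [coeff_add, coeff_C_mul, coeff_X_pow]
    norm_num
  rw [howe_split]
  simp only [coeff_add, coeff_C_mul, coeff_mul_X_pow']
  norm_num [g_coeff_3, g_coeff_5, g_coeff_7, g_coeff_9, h10]
  ring

lemma howe_coeff_13 {R : Type*} [CommRing R] (a b l : R) :
    (((X ^ 3 + C a * X) * ((X - C l) ^ 3 + C b * (X - C l)) : R[X]) ^ 3).coeff 13 =
    (-126)*l^5 + (-105)*b^1*l^3 + (-15)*b^2*l^1 + (-252)*a^1*l^3 + (-63)*a^1*b^1*l^1 + (-27)*a^2*l^1 := by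
  have h10 : (((X - C l) ^ 3 + C b * (X - C l) : R[X]) ^ 3).coeff 10 = 0 := by
    rw [howe_expand]
    simp only [coeff_add, coeff_C_mul, coeff_X_pow]
    norm_num
  rw [howe_split]
  simp only [coeff_add, coeff_C_mul, coeff_mul_X_pow']
  norm_num [g_coeff_4, g_coeff_6, g_coeff_8, h10]
  ring

lemma ss_coeff {R : Type*} [CommRing R] (a b : R) :
    ((X ^ 3 + C a * X + C b : R[X]) ^ 3).coeff 6 = 3 * b := by
  have : (X ^ 3 + C a * X + C b : R[X]) ^ 3 = X^9 + C (3*a) * X^7 + C (3*b) * X^6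
    + C (3*a^2) * X^5 + C (6*a*b) * X^4 + C (a^3+3*b^2) * X^3 + C (3*a^2*b) * X^2
    + C (3*a*b^2) * X^1 + C (b^3) * X^0 := by
    simp only [map_add, map_mul, map_pow, map_ofNat]
    ring
  rw [this]
  simp only [coeff_add, coeff_C_mul, coeff_X_pow]
  norm_num

/-- There is no superspecial Howe curve in characteristic `7`: no parameters
`A₁, B₁, A₂, B₂, λ, μ, ν ∈ 𝔽₄₉` give supersingular `E₁, E₂` (vanishing of the `x⁶`
coefficient of `(x³ + Aᵢx + Bᵢ)³`), a Howe-type triple `(λ, μ, ν)`, and vanishing of the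
coefficients of `x⁶, x¹³, x⁵, x¹²` in `(f₁f₂)³` (the Cartier–Manin entries). -/
theorem no_superspecial_howe_curve_char_seven :
    ¬ ∃ A₁ B₁ A₂ B₂ lam mu nu : GaloisField 7 2,
      (4 * A₁ ^ 3 + 27 * B₁ ^ 2 ≠ 0) ∧
      (4 * A₂ ^ 3 + 27 * B₂ ^ 2 ≠ 0) ∧
      (((X ^ 3 + C A₁ * X + C B₁ : (GaloisField 7 2)[X]) ^ 3).coeff 6 = 0) ∧
      (((X ^ 3 + C A₂ * X + C B₂ : (GaloisField 7 2)[X]) ^ 3).coeff 6 = 0) ∧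
      mu ≠ 0 ∧ nu ≠ 0 ∧
      IsCoprime
        (X ^ 3 + C (A₁ * mu ^ 2) * X + C (B₁ * mu ^ 3) : (GaloisField 7 2)[X])
        ((X - C lam) ^ 3 + C (A₂ * nu ^ 2) * (X - C lam) + C (B₂ * nu ^ 3)) ∧
      ((((X ^ 3 + C (A₁ * mu ^ 2) * X + C (B₁ * mu ^ 3)) *
          ((X - C lam) ^ 3 + C (A₂ * nu ^ 2) * (X - C lam) + C (B₂ * nu ^ 3)) :
            (GaloisField 7 2)[X]) ^ 3).coeff 6 = 0) ∧
      ((((X ^ 3 + C (A₁ * mu ^ 2) * X + C (B₁ * mu ^ 3)) *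
          ((X - C lam) ^ 3 + C (A₂ * nu ^ 2) * (X - C lam) + C (B₂ * nu ^ 3)) :
            (GaloisField 7 2)[X]) ^ 3).coeff 13 = 0) ∧
      ((((X ^ 3 + C (A₁ * mu ^ 2) * X + C (B₁ * mu ^ 3)) *
          ((X - C lam) ^ 3 + C (A₂ * nu ^ 2) * (X - C lam) + C (B₂ * nu ^ 3)) :
            (GaloisField 7 2)[X]) ^ 3).coeff 5 = 0) ∧
      ((((X ^ 3 + C (A₁ * mu ^ 2) * X + C (B₁ * mu ^ 3)) *
          ((X - C lam) ^ 3 + C (A₂ * nu ^ 2) * (X - C lam) + C (B₂ * nu ^ 3)) :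
            (GaloisField 7 2)[X]) ^ 3).coeff 12 = 0) := by
  rintro ⟨A₁, B₁, A₂, B₂, l, mu, nu, d1, d2, s1, s2, hm, hn, hc, h6, h13, -, h12⟩
  have h7 : (7 : GaloisField 7 2) = 0 := by exact_mod_cast CharP.cast_eq_zero (GaloisField 7 2) 7
  have h3 : (3 : GaloisField 7 2) ≠ 0 := by
    intro h
    have : (1 : GaloisField 7 2) = 0 := by linear_combination h7 - 2 * h
    exact one_ne_zero this
  rw [ss_coeff] at s1 s2
  have hB1 : B₁ = 0 := by simpa [h3] using s1
  have hB2 : B₂ = 0 := by simpa [h3] using s2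
  subst hB1 hB2
  have hA1 : A₁ ≠ 0 := by rintro rfl; simp at d1
  have hA2 : A₂ ≠ 0 := by rintro rfl; simp at d2
  have ha : A₁ * mu ^ 2 ≠ 0 := mul_ne_zero hA1 (pow_ne_zero _ hm)
  have hb : A₂ * nu ^ 2 ≠ 0 := mul_ne_zero hA2 (pow_ne_zero _ hn)
  generalize A₁ * mu ^ 2 = a at *
  generalize A₂ * nu ^ 2 = b at *
  simp only [zero_mul, map_zero, add_zero] at hc h6 h13 h12
  have hl : l ≠ 0 := by
    rintro rfl
    obtain ⟨u, v, huv⟩ := hc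
    have := congrArg (Polynomial.eval 0) huv
    simp at this
  rw [howe_coeff_6] at h6
  rw [howe_coeff_12] at h12
  rw [howe_coeff_13] at h13
  have k13 : l * ((a - b) * (a + b)) = 0 := by
    linear_combination h13 - h7 * (-18*l^5-15*b*l^3-2*b^2*l-36*a*l^3-9*a*b*l-4*a^2*l)
  have k := (mul_eq_zero.mp k13).resolve_left hl
  rcases mul_eq_zero.mp k with k | k
  · obtain rfl : a = b := sub_eq_zero.mp k
    have k12 : a ^ 2 * (a - 5 * l ^ 2) = 0 := by
      linear_combination -h12 + h7 * (3*a^3+46*a^2*l^2+69*a*l^4+12*l^6)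
    have k' := (mul_eq_zero.mp k12).resolve_left (pow_ne_zero _ ha)
    obtain rfl : a = 5 * l ^ 2 := sub_eq_zero.mp k'
    have : l ^ 12 = 0 := by linear_combination 1 * h6 - h7 * (35757 * l ^ 12)
    exact hl (pow_eq_zero_iff (by norm_num) |>.mp this)
  · obtain rfl : b = -a := by linear_combination k
    have : a ^ 2 * l ^ 2 = 0 := by
      linear_combination -4 * h12 + h7 * (4 * (-7*a^2*l^2+39*a*l^4+12*l^6) - a^2*l^2)
    exact mul_ne_zero (pow_ne_zero _ ha) (pow_ne_zero _ hl) this
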